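/- Let i be an integer with 1 ≤ i < (p-1)/2, and set C(i) = {(x,y) ∈ N × N : x ∈ g_i \ g_{i+1} and [x,y] = 0}. Then the map φ : (g_i \ g_{i+1}) × g_{p-1-i} × k → C(i) given by φ(x, z, a) = (x, a•x + z) is well defined and bijective. -/

import Mathlib

open Polynomial

set_option synthInstance.maxHeartbeats 1000000
set_option maxHeartbeats 1000000

/-- The truncated polynomial algebra `A = k[X]/(X^p)`. -/
noncomputable abbrev WittA (k : Type*) [Field k] (p : ℕ) : Type _ :=
  k[X] ⧸ Ideal.span ({X ^ p} : Set k[X])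

/-- The coset of `X` in `A = k[X]/(X^p)`. -/
noncomputable abbrev WittX (k : Type*) [Field k] (p : ℕ) : WittA k p :=
  Ideal.Quotient.mk (Ideal.span ({X ^ p} : Set k[X])) X



namespace WittAux

variable {k : Type*} [Field k] {p : ℕ}

lemma der_mk (D : Derivation k (WittA k p) (WittA k p)) (P : k[X]) :
    D (Ideal.Quotient.mk _ P) = Ideal.Quotient.mk _ (derivative P) * D (WittX k p) := by
  induction P using Polynomial.induction_on' with
  | add P Q hP hQ => simp only [map_add, hP, hQ, add_mul]
  | monomial n a =>
    have h1 : (Ideal.Quotient.mk (Ideal.span ({X ^ p} : Set k[X])) (monomial n a))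
        = a • (WittX k p) ^ n := by
      rw [← Polynomial.C_mul_X_pow_eq_monomial, ← Polynomial.smul_eq_C_mul]
      rfl
    have h2 : (Ideal.Quotient.mk (Ideal.span ({X ^ p} : Set k[X])) (derivative (monomial n a)))
        = a • ((n : WittA k p) * (WittX k p) ^ (n - 1)) := by
      rw [← Polynomial.C_mul_X_pow_eq_monomial, ← Polynomial.smul_eq_C_mul, derivative_smul,
        derivative_X_pow, ← map_natCast (Ideal.Quotient.mk (Ideal.span ({X ^ p} : Set k[X]))) n]
      rfl
    rw [h1, h2, D.map_smul, Derivation.leibniz_pow, smul_mul_assoc]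
    simp only [nsmul_eq_mul, smul_eq_mul, mul_assoc]

lemma mem_iff {j : ℕ} (hj : j ≤ p) (P : k[X]) :
    (Ideal.Quotient.mk (Ideal.span ({X ^ p} : Set k[X])) P : WittA k p) ∈
      Ideal.span {WittX k p ^ j} ↔ X ^ j ∣ P := by
  rw [Ideal.mem_span_singleton]
  constructor
  · rintro ⟨c, hc⟩
    obtain ⟨C, rfl⟩ := Ideal.Quotient.mk_surjective c
    rw [← map_pow, ← map_mul, Ideal.Quotient.eq, Ideal.mem_span_singleton] at hc
    have := (pow_dvd_pow X hj).trans hc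
    exact (dvd_sub_left (dvd_mul_right _ _)).mp this
  · rintro ⟨c, rfl⟩
    exact ⟨Ideal.Quotient.mk _ c, by rw [map_mul, map_pow]⟩

lemma ext_X {D E : Derivation k (WittA k p) (WittA k p)}
    (h : D (WittX k p) = E (WittX k p)) : D = E := by
  apply Derivation.ext
  intro a
  obtain ⟨P, rfl⟩ := Ideal.Quotient.mk_surjective a
  rw [der_mk D P, der_mk E P, h]

lemma X_mul_der (m : ℕ) (v : k[X]) :
    X * derivative (X ^ m * v) = X ^ m * ((m : k[X]) * v + X * derivative v) := by
  rw [derivative_mul, derivative_X_pow]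
  cases m with
  | zero => simp
  | succ n => simp; ring

lemma bracket_iff {D E : Derivation k (WittA k p) (WittA k p)} {F G : k[X]}
    (hF : D (WittX k p) = Ideal.Quotient.mk _ F) (hG : E (WittX k p) = Ideal.Quotient.mk _ G) :
    ⁅D, E⁆ = 0 ↔ X ^ p ∣ derivative G * F - derivative F * G := by
  have h : ⁅D, E⁆ (WittX k p) = Ideal.Quotient.mk _ (derivative G * F - derivative F * G) := by
    rw [Derivation.commutator_apply, hF, hG, der_mk D G, der_mk E F, hF, hG, map_sub, map_mul, map_mul]
  rw [← Ideal.mem_span_singleton, ← Ideal.Quotient.eq_zero_iff_mem, ← h]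
  constructor
  · intro h; rw [h]; rfl
  · intro h; exact ext_X (by rw [h]; rfl)

lemma nilp {D : Derivation k (WittA k p) (WittA k p)} {F : k[X]}
    (hF : D (WittX k p) = Ideal.Quotient.mk _ F) (h2 : X ^ 2 ∣ F) : D.toLinearMap ^ p = 0 := by
  have key : ∀ n : ℕ, ∀ a, ∃ Q : k[X],
      (D.toLinearMap ^ n) a = Ideal.Quotient.mk (Ideal.span ({X ^ p} : Set k[X])) (X ^ n * Q) := by
    intro n
    induction n with
    | zero =>
      intro a
      obtain ⟨P, rfl⟩ := Ideal.Quotient.mk_surjective a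
      exact ⟨P, by simp⟩
    | succ n ih =>
      intro a
      obtain ⟨Q, hQ⟩ := ih a
      obtain ⟨W, rfl⟩ := h2
      refine ⟨((n : k[X]) * Q + X * derivative Q) * W, ?_⟩
      rw [pow_succ', Module.End.mul_apply, hQ]
      change D _ = _
      rw [der_mk, hF, ← map_mul]
      congr 1
      linear_combination (X * W) * X_mul_der n Q
  apply LinearMap.ext
  intro a
  obtain ⟨Q, hQ⟩ := key p a
  rw [hQ, LinearMap.zero_apply, Ideal.Quotient.eq_zero_iff_mem, Ideal.mem_span_singleton]
  exact dvd_mul_right _ _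

lemma wr (m n : ℕ) (u v : k[X]) :
    X * (derivative (X ^ m * v) * (X ^ n * u) - derivative (X ^ n * u) * (X ^ m * v)) =
      X ^ (m + n) * (((m : k[X]) * v + X * derivative v) * u
        - ((n : k[X]) * u + X * derivative u) * v) := by
  have h1 := X_mul_der m v
  have h2 := X_mul_der n u
  rw [pow_add]
  linear_combination (X ^ n * u) * h1 - (X ^ m * v) * h2

lemma step [CharP k p] {m n : ℕ} {F H : k[X]} (hF : X ^ n ∣ F) (hF' : ¬ X ^ (n + 1) ∣ F)
    (hH : X ^ m ∣ H) (hmn : m ≠ n) (hmp : m < p) (hnp : n < p) (hs : m + n ≤ p)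
    (hb : X ^ p ∣ derivative H * F - derivative F * H) : X ^ (m + 1) ∣ H := by
  obtain ⟨u, rfl⟩ := hF
  obtain ⟨v, rfl⟩ := hH
  have h := mul_dvd_mul_left X hb
  rw [wr, ← pow_succ'] at h
  have h' := (pow_dvd_pow (X : k[X]) (Nat.succ_le_succ hs)).trans h
  rw [Nat.succ_eq_add_one, pow_succ, mul_dvd_mul_iff_left (pow_ne_zero _ X_ne_zero)] at h'
  rw [pow_succ, mul_dvd_mul_iff_left (pow_ne_zero _ X_ne_zero)] at hF' ⊢
  rw [X_dvd_iff] at *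
  simp only [coeff_sub, mul_coeff_zero, coeff_add, coeff_X_zero, zero_mul, add_zero,
    coeff_natCast_ite, if_true] at h'
  have h3 : ((m : k) - n) * (u.coeff 0 * v.coeff 0) = 0 := by
    linear_combination h'
  have h4 : (m : k) - n ≠ 0 := by
    rw [sub_ne_zero]
    intro h
    rw [CharP.natCast_eq_natCast k p] at h
    exact hmn (Nat.ModEq.eq_of_lt_of_lt h hmp hnp)
  rcases mul_eq_zero.mp h3 with h | h
  · exact absurd h h4
  · exact (mul_eq_zero.mp h).resolve_left hF'

lemma main [CharP k p] {i : ℕ} (hi1 : 1 ≤ i) (hi2 : 2 * i < p - 1) {F G : k[X]}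
    (hF : X ^ (i + 1) ∣ F) (hF' : ¬ X ^ (i + 2) ∣ F)
    (hb : X ^ p ∣ derivative G * F - derivative F * G) :
    ∃ a : k, X ^ (p - i) ∣ G - a • F := by
  have h1 : ∀ m, m ≤ i + 1 → X ^ m ∣ G := by
    intro m
    induction m with
    | zero => simp
    | succ m ih =>
      intro hm
      exact step hF hF' (ih (by omega)) (by omega) (by omega) (by omega) (by omega) hb
  obtain ⟨v, rfl⟩ := h1 _ le_rfl
  obtain ⟨u, rfl⟩ := id hF
  have hu : u.coeff 0 ≠ 0 := by
    intro h
    apply hF'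
    rw [← X_dvd_iff] at h
    rw [pow_succ X (i + 1)]
    exact mul_dvd_mul_left _ h
  refine ⟨v.coeff 0 / u.coeff 0, ?_⟩
  set a := v.coeff 0 / u.coeff 0 with ha
  set G := X ^ (i + 1) * v
  set F := X ^ (i + 1) * u
  have hb' : X ^ p ∣ derivative (G - a • F) * F - derivative F * (G - a • F) := by
    convert hb using 1
    rw [derivative_sub, derivative_smul, smul_eq_C_mul, smul_eq_C_mul]
    ring
  have h2 : X ^ (i + 2) ∣ G - a • F := by
    have : G - a • F = X ^ (i + 1) * (v - a • u) := by
      rw [smul_eq_C_mul, smul_eq_C_mul]; ring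
    rw [this, pow_succ X (i + 1)]
    apply mul_dvd_mul_left
    rw [X_dvd_iff, coeff_sub, coeff_smul, smul_eq_mul, ha]
    field_simp
    simp
  have h3 : ∀ m, i + 2 ≤ m → m ≤ p - i → X ^ m ∣ G - a • F := by
    intro m hm
    induction m, hm using Nat.le_induction with
    | base => intro _; exact h2
    | succ m hm ih =>
      intro hm'
      exact step hF hF' (ih (by omega)) (by omega) (by omega) (by omega) (by omega) hb'
  exact h3 _ (by omega) le_rfl

lemma bracket_zero {i : ℕ} (hip : i ≤ p) {F Z : k[X]}
    (hF : X ^ (i + 1) ∣ F) (hZ : X ^ (p - i) ∣ Z) :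
    X ^ p ∣ derivative Z * F - derivative F * Z := by
  obtain ⟨u, rfl⟩ := hF
  obtain ⟨v, rfl⟩ := hZ
  rw [← mul_dvd_mul_iff_left (X_ne_zero (R := k)), wr, ← pow_succ',
    show p - i + (i + 1) = p + 1 by omega]
  exact dvd_mul_right _ _

end WittAux

/-- For `1 ≤ i < (p-1)/2`, the map `φ(x, z, a) = (x, a • x + z)` is a well-defined bijection
from `(g_i \ g_{i+1}) × g_{p-1-i} × k` onto
`C(i) = {(x,y) ∈ N × N : x ∈ g_i \ g_{i+1}, [x,y] = 0}`.
Here `g_j = {d : d(X) ∈ X^{j+1}·A}` and `N = {x : x^p = 0}`. -/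
theorem witt_Ci_parametrization (p : ℕ) (hp : p.Prime) (hp3 : 3 < p)
    (k : Type*) [Field k] [IsAlgClosed k] [CharP k p]
    (i : ℕ) (hi1 : 1 ≤ i) (hi2 : 2 * i < p - 1) :
    Set.BijOn
      (fun t : Derivation k (WittA k p) (WittA k p) ×
          Derivation k (WittA k p) (WittA k p) × k => (t.1, t.2.2 • t.1 + t.2.1))
      ({x : Derivation k (WittA k p) (WittA k p) |
          x (WittX k p) ∈ Ideal.span {WittX k p ^ (i + 1)} ∧
            x (WittX k p) ∉ Ideal.span {WittX k p ^ (i + 2)}} ×ˢ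
        ({z : Derivation k (WittA k p) (WittA k p) |
            z (WittX k p) ∈ Ideal.span {WittX k p ^ (p - i)}} ×ˢ (Set.univ : Set k)))
      {q : Derivation k (WittA k p) (WittA k p) × Derivation k (WittA k p) (WittA k p) |
        (q.1.toLinearMap ^ p = 0 ∧ q.2.toLinearMap ^ p = 0) ∧
        (q.1 (WittX k p) ∈ Ideal.span {WittX k p ^ (i + 1)} ∧
          q.1 (WittX k p) ∉ Ideal.span {WittX k p ^ (i + 2)}) ∧ ⁅q.1, q.2⁆ = 0} := by
  have mk_smul : ∀ (a : k) (P : k[X]),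
      (Ideal.Quotient.mk (Ideal.span ({X ^ p} : Set k[X])) (a • P) : WittA k p) =
        a • (Ideal.Quotient.mk (Ideal.span ({X ^ p} : Set k[X])) P : WittA k p) :=
    fun _ _ => rfl
  refine ⟨?_, ?_, ?_⟩
  · rintro ⟨x, z, a⟩ ⟨⟨hx1, hx2⟩, hz, -⟩
    simp only [Set.mem_ofPred_eq] at hx1 hx2 hz ⊢
    obtain ⟨F, hF⟩ := Ideal.Quotient.mk_surjective (x (WittX k p))
    obtain ⟨Z, hZ⟩ := Ideal.Quotient.mk_surjective (z (WittX k p))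
    refine ⟨⟨?_, ?_⟩, ⟨hx1, hx2⟩, ?_⟩
    all_goals
      rw [← hF, WittAux.mem_iff (by omega)] at hx1
      rw [← hZ, WittAux.mem_iff (by omega)] at hz
    · exact WittAux.nilp hF.symm ((pow_dvd_pow X (by omega)).trans hx1)
    · refine WittAux.nilp (F := a • F + Z) ?_ ?_
      · rw [map_add, mk_smul, hF, hZ]; rfl
      · refine dvd_add ?_ ((pow_dvd_pow X (by omega)).trans hz)
        rw [smul_eq_C_mul]
        exact ((pow_dvd_pow X (by omega)).trans hx1).mul_left _
    · have hy : (a • x + z) (WittX k p) = Ideal.Quotient.mk _ (a • F + Z) := by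
        rw [map_add, mk_smul, hF, hZ]; rfl
      refine (WittAux.bracket_iff hF.symm hy).mpr ?_
      have h := WittAux.bracket_zero (i := i) (p := p) (by omega) hx1 hz
      convert h using 1
      rw [derivative_add, derivative_smul, smul_eq_C_mul, smul_eq_C_mul]
      ring
  · rintro ⟨x, z, a⟩ ⟨⟨hx1, hx2⟩, hz, -⟩ ⟨x', z', a'⟩ ⟨-, hz', -⟩ h
    simp only [Set.mem_ofPred_eq, Prod.mk.injEq] at hx1 hx2 hz hz' h
    obtain ⟨rfl, h⟩ := h
    have hX : a • x (WittX k p) + z (WittX k p) = a' • x (WittX k p) + z' (WittX k p) :=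
      congrArg (fun D : Derivation k (WittA k p) (WittA k p) => D (WittX k p)) h
    have haa : a = a' := by
      by_contra hne
      apply hx2
      have hs : a - a' ≠ 0 := sub_ne_zero.mpr hne
      have e2 : x (WittX k p) = (a - a')⁻¹ • (z' (WittX k p) - z (WittX k p)) := by
        have e : (a - a') • x (WittX k p) = z' (WittX k p) - z (WittX k p) := by
          rw [sub_smul, sub_eq_sub_iff_add_eq_add, hX]; exact add_comm _ _
        rw [← e, smul_smul, inv_mul_cancel₀ hs, one_smul]
      rw [e2]
      apply Submodule.smul_of_tower_mem
      have hle : Ideal.span {WittX k p ^ (p - i)} ≤ Ideal.span {WittX k p ^ (i + 2)} := by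
        rw [Ideal.span_singleton_le_span_singleton]
        exact pow_dvd_pow _ (by omega)
      exact hle (Ideal.sub_mem _ hz' hz)
    subst haa
    rw [WittAux.ext_X (add_left_cancel hX)]
  · rintro ⟨x, y⟩ ⟨-, ⟨hx1, hx2⟩, hb⟩
    simp only at hx1 hx2 hb
    obtain ⟨F, hF⟩ := Ideal.Quotient.mk_surjective (x (WittX k p))
    obtain ⟨G, hG⟩ := Ideal.Quotient.mk_surjective (y (WittX k p))
    rw [WittAux.bracket_iff hF.symm hG.symm] at hb
    have hx1' := hx1
    have hx2' := hx2
    rw [← hF, WittAux.mem_iff (by omega)] at hx1' hx2'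
    obtain ⟨a, ha⟩ := WittAux.main hi1 hi2 hx1' hx2' hb
    refine ⟨(x, y - a • x, a), ⟨⟨hx1, hx2⟩, ?_, trivial⟩, ?_⟩
    · rw [← WittAux.mem_iff (p := p) (by omega), map_sub, mk_smul, hF, hG] at ha
      exact ha
    · refine Prod.ext rfl (WittAux.ext_X ?_)
      change a • x (WittX k p) + (y (WittX k p) - a • x (WittX k p)) = y (WittX k p)
      exact add_sub_cancel _ _
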